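/- arXiv:2309.12897 — 2 statements merged into one kernel-verified Lean document; each statement's English description precedes it below -/
import Mathlib

section
/- (Lemma 1) For every y = (a,b) ∈ E, the point (w,w), where wᵢ = max((aᵢ + bᵢ)/2, 0) for each i, belongs to M and is the unique minimizer of ‖u − y‖² over u ∈ M; that is, the orthogonal projection of y onto M is Π_M(y) = [½(I+P)y]⁺, where [·]⁺ denotes the componentwise positive part. -/
open RealInnerProductSpace

/-- The product space `E = ℝ^m × ℝ^m` with the ℓ²-product inner product and norm. -/
abbrev E (m : ℕ) : Type :=
  WithLp 2 (EuclideanSpace ℝ (Fin m) × EuclideanSpace ℝ (Fin m))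

/-- The pairing map `(a, b) ↦ (a, b) ∈ E`. -/
noncomputable def mkE {m : ℕ} (a b : EuclideanSpace ℝ (Fin m)) : E m :=
  (WithLp.equiv 2 _).symm (a, b)

/-- The set `M = {(u,u) : u ∈ ℝ^m, uᵢ ≥ 0 for all i}`. -/
def Mset (m : ℕ) : Set (E m) :=
  {y | ∃ u : EuclideanSpace ℝ (Fin m), (∀ i, 0 ≤ u i) ∧ y = mkE u u}

theorem norm_sq_mkE_sub_mkE {m : ℕ} (u v a b : EuclideanSpace ℝ (Fin m)) :
    ‖mkE u v - mkE a b‖ ^ 2 = ∑ i, ((u i - a i) ^ 2 + (v i - b i) ^ 2) := by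
  rw [WithLp.prod_norm_sq_eq_of_L2, EuclideanSpace.norm_sq_eq, EuclideanSpace.norm_sq_eq,
    ← Finset.sum_add_distrib]
  simp [mkE]

/-- The obtuse-angle inequality for the projection of `(a, b)` onto the ray
`{(u, u) : 0 ≤ u}` in the plane. -/
theorem sq_dist_posPart_midpoint_add_le (a b u : ℝ) (hu : 0 ≤ u) :
    ((max ((a + b) / 2) 0 - a) ^ 2 + (max ((a + b) / 2) 0 - b) ^ 2) +
        2 * (u - max ((a + b) / 2) 0) ^ 2 ≤ (u - a) ^ 2 + (u - b) ^ 2 := by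
  rcases max_cases ((a + b) / 2) 0 with ⟨h, -⟩ | ⟨h, hab⟩
  · rw [h]
    apply le_of_eq
    ring
  · rw [h]
    nlinarith

/-- Lemma 1: for `y = (a,b)`, the point `(w,w)` with `wᵢ = max((aᵢ+bᵢ)/2, 0)` belongs to `M`
and is the unique minimizer of `‖u − y‖²` over `u ∈ M`; i.e. `Π_M(y) = [½(I+P)y]⁺`. -/
theorem stmt_1 (m : ℕ) (hm : 0 < m) (a b : EuclideanSpace ℝ (Fin m)) :
    let w : EuclideanSpace ℝ (Fin m) :=
      (WithLp.equiv 2 _).symm fun i => max ((a i + b i) / 2) 0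
    mkE w w ∈ Mset m ∧
      (∀ u ∈ Mset m, ‖mkE w w - mkE a b‖ ^ 2 ≤ ‖u - mkE a b‖ ^ 2) ∧
      (∀ u ∈ Mset m, ‖u - mkE a b‖ ^ 2 = ‖mkE w w - mkE a b‖ ^ 2 → u = mkE w w) := by
  intro w
  have key : ∀ u : EuclideanSpace ℝ (Fin m), (∀ i, 0 ≤ u i) →
      ‖mkE w w - mkE a b‖ ^ 2 + ∑ i, 2 * (u i - w i) ^ 2 ≤ ‖mkE u u - mkE a b‖ ^ 2 := by
    intro u hu
    rw [norm_sq_mkE_sub_mkE, norm_sq_mkE_sub_mkE, ← Finset.sum_add_distrib]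
    exact Finset.sum_le_sum fun i _ => sq_dist_posPart_midpoint_add_le (a i) (b i) (u i) (hu i)
  have nonneg : ∀ u : EuclideanSpace ℝ (Fin m), ∀ i ∈ Finset.univ, 0 ≤ 2 * (u i - w i) ^ 2 :=
    fun u i _ => by positivity
  refine ⟨⟨w, fun i => le_max_right _ _, rfl⟩, ?_, ?_⟩
  · rintro _ ⟨u, hu, rfl⟩
    linarith [key u hu, Finset.sum_nonneg (nonneg u)]
  · rintro _ ⟨u, hu, rfl⟩ h
    have hzero : ∑ i, 2 * (u i - w i) ^ 2 = 0 :=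
      le_antisymm (by linarith [key u hu]) (Finset.sum_nonneg (nonneg u))
    have huw : u = w := by
      ext i
      have hi := (Finset.sum_eq_zero_iff_of_nonneg (nonneg u)).mp hzero i (Finset.mem_univ i)
      have hsq : (u i - w i) ^ 2 = 0 := by linarith
      exact sub_eq_zero.mp (pow_eq_zero_iff two_ne_zero |>.mp hsq)
    rw [huw]
end

section
/- (Threshold/exchange rule) For every y = (a,b) ∈ E and every index i: if aᵢ + bᵢ > 0 then the i-th component of the first block of R_M(a,b) equals bᵢ and the i-th component of the second block equals aᵢ (the values are exchanged); if aᵢ + bᵢ ≤ 0 then these components equal −aᵢ and −bᵢ respectively (the values are negated). -/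
open RealInnerProductSpace

theorem norm_mkE_sub_mkE_sq {m : ℕ} (v a b : EuclideanSpace ℝ (Fin m)) :
    ‖mkE v v - mkE a b‖ ^ 2 = ∑ j, ((v j - a j) ^ 2 + (v j - b j) ^ 2) := by
  rw [WithLp.prod_norm_sq_eq_of_L2, Finset.sum_add_distrib]
  simp [mkE, EuclideanSpace.norm_sq_eq]

/-- A nearest point `(u, u)` of `Mset m` to `(a, b)` is also nearest in each coordinate. -/
theorem coord_le_of_nearest {m : ℕ} {u a b : EuclideanSpace ℝ (Fin m)} (hu : ∀ j, 0 ≤ u j)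
    (hmin : ∀ y ∈ Mset m, ‖mkE u u - mkE a b‖ ≤ ‖y - mkE a b‖) (i : Fin m) {t : ℝ} (ht : 0 ≤ t) :
    (u i - a i) ^ 2 + (u i - b i) ^ 2 ≤ (t - a i) ^ 2 + (t - b i) ^ 2 := by
  set v : EuclideanSpace ℝ (Fin m) := WithLp.toLp 2 (Function.update u i t) with hv
  have hvi : v i = t := by simp [hv]
  have hvj : ∀ j, j ≠ i → v j = u j := fun j hj => by simp [hv, hj]
  have hv0 : ∀ j, 0 ≤ v j := fun j => by
    by_cases hj : j = i
    · rw [hj, hvi]; exact ht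
    · rw [hvj j hj]; exact hu j
  have h := pow_le_pow_left₀ (norm_nonneg _) (hmin _ ⟨v, hv0, rfl⟩) 2
  rw [norm_mkE_sub_mkE_sq, norm_mkE_sub_mkE_sq, ← Finset.add_sum_erase _ _ (Finset.mem_univ i),
    ← Finset.add_sum_erase _ _ (Finset.mem_univ i), hvi,
    Finset.sum_congr rfl fun j hj => by rw [← hvj j (Finset.ne_of_mem_erase hj)]] at h
  exact le_of_add_le_add_right h

/-- Threshold/exchange rule: for `y = (a,b)` and any index `i`, if `aᵢ + bᵢ > 0` then the
`i`-th components of the two blocks of `R_M(a,b) = 2Π_M(a,b) − (a,b)` are `bᵢ` and `aᵢ`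
(exchange); if `aᵢ + bᵢ ≤ 0` they are `−aᵢ` and `−bᵢ` (negation). -/
theorem stmt_3 (m : ℕ) (hm : 0 < m) (proj : E m → E m)
    (hproj : ∀ y : E m, proj y ∈ Mset m ∧ ∀ u ∈ Mset m, ‖proj y - y‖ ≤ ‖u - y‖)
    (a b : EuclideanSpace ℝ (Fin m)) (i : Fin m) :
    (0 < a i + b i →
      ((WithLp.equiv 2 _) ((2 : ℝ) • proj (mkE a b) - mkE a b)).1 i = b i ∧
      ((WithLp.equiv 2 _) ((2 : ℝ) • proj (mkE a b) - mkE a b)).2 i = a i) ∧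
    (a i + b i ≤ 0 →
      ((WithLp.equiv 2 _) ((2 : ℝ) • proj (mkE a b) - mkE a b)).1 i = -a i ∧
      ((WithLp.equiv 2 _) ((2 : ℝ) • proj (mkE a b) - mkE a b)).2 i = -b i) := by
  obtain ⟨⟨u, hu, hpu⟩, hmin⟩ := hproj (mkE a b)
  rw [hpu] at hmin ⊢
  have key := fun t (ht : (0 : ℝ) ≤ t) => coord_le_of_nearest hu hmin i ht
  have h₁ : ((WithLp.equiv 2 _) ((2 : ℝ) • mkE u u - mkE a b)).1 i = 2 * u i - a i := by
    simp [mkE]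
  have h₂ : ((WithLp.equiv 2 _) ((2 : ℝ) • mkE u u - mkE a b)).2 i = 2 * u i - b i := by
    simp [mkE]
  rw [h₁, h₂]
  constructor
  · intro hab
    have h := key ((a i + b i) / 2) (by linarith)
    have hz : u i - (a i + b i) / 2 = 0 :=
      pow_eq_zero_iff two_ne_zero |>.1 (le_antisymm (by nlinarith) (sq_nonneg _))
    constructor <;> linarith
  · intro hab
    have h := key 0 le_rfl
    have hz : u i = 0 :=
      pow_eq_zero_iff two_ne_zero |>.1
        (le_antisymm (by nlinarith [mul_nonneg (hu i) (neg_nonneg.2 hab)]) (sq_nonneg _))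
    constructor <;> linarith
end
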